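/- arXiv:1611.06968 — 3 statements merged into one kernel-verified Lean document; each statement's English description precedes it below -/
import Mathlib

section
/- Let q be a real number with q > 0 and q ≠ 1, let w₁, w₂ ∈ ℝ be such that none of w₁, w₂, w₁ + w₂, w₁ − w₂ is an integer, let m, t be nonnegative integers with m ≡ t (mod 2) and (m, t) ≠ (0, 0), and let ε₁, ε₂, η₁, η₂ ∈ {1, −1}. If q^{−m+ε₁w₁+ε₂w₂} + q^{m−ε₁w₁−ε₂w₂} = q^{−t+η₁w₁+η₂w₂} + q^{t−η₁w₁−η₂w₂}, then m = t, ε₁ = η₁ and ε₂ = η₂. -/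
/-- `q ^ x + q ^ (-x)` determines `x` up to sign. -/
theorem eq_or_eq_neg_of_rpow_add_rpow_neg_eq {q x y : ℝ} (hq0 : 0 < q) (hq1 : q ≠ 1)
    (h : q ^ x + q ^ (-x) = q ^ y + q ^ (-y)) : x = y ∨ x = -y := by
  have hx := Real.rpow_pos_of_pos hq0 x
  have hy := Real.rpow_pos_of_pos hq0 y
  have key : (q ^ x - q ^ y) * (q ^ x * q ^ y - 1) = 0 := by
    rw [Real.rpow_neg hq0.le, Real.rpow_neg hq0.le] at h
    field_simp at h
    linear_combination h
  rcases mul_eq_zero.mp key with h | h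
  · exact Or.inl ((Real.rpow_right_inj hq0 hq1).mp (sub_eq_zero.mp h))
  · right
    rw [← Real.rpow_add hq0, sub_eq_zero, ← Real.rpow_zero q, Real.rpow_right_inj hq0 hq1] at h
    linarith

/-- Signed sums of `w₁` and `w₂` with different signs do not differ by an even integer, when none of
`w₁, w₂, w₁ + w₂, w₁ - w₂` is an integer. -/
theorem signs_eq_of_signed_sum_sub_eq_even {w1 w2 : ℝ}
    (hw1 : ∀ k : ℤ, w1 ≠ k) (hw2 : ∀ k : ℤ, w2 ≠ k)
    (hw12 : ∀ k : ℤ, w1 + w2 ≠ k) (hw12' : ∀ k : ℤ, w1 - w2 ≠ k) {e1 e2 h1 h2 : ℝ}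
    (he1 : e1 = 1 ∨ e1 = -1) (he2 : e2 = 1 ∨ e2 = -1)
    (hh1 : h1 = 1 ∨ h1 = -1) (hh2 : h2 = 1 ∨ h2 = -1) (k : ℤ)
    (h : (e1 * w1 + e2 * w2) - (h1 * w1 + h2 * w2) = 2 * k) :
    e1 = h1 ∧ e2 = h2 := by
  have ne_and_ne_neg {w : ℝ} (hw : ∀ k : ℤ, w ≠ k) : w ≠ k ∧ w ≠ -k :=
    ⟨hw k, by exact_mod_cast hw (-k)⟩
  obtain ⟨a, a'⟩ := ne_and_ne_neg hw1
  obtain ⟨b, b'⟩ := ne_and_ne_neg hw2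
  obtain ⟨c, c'⟩ := ne_and_ne_neg hw12
  obtain ⟨d, d'⟩ := ne_and_ne_neg hw12'
  rcases he1 with rfl | rfl <;> rcases he2 with rfl | rfl <;>
    rcases hh1 with rfl | rfl <;> rcases hh2 with rfl | rfl <;> grind

/-- if `q > 0`, `q ≠ 1`, and none of `w₁, w₂, w₁+w₂, w₁−w₂` is an
integer, then equality of eigenvalue data forces equality of labels. -/
theorem eigenvalues_distinct (q : ℝ) (hq0 : 0 < q) (hq1 : q ≠ 1) (w1 w2 : ℝ)
    (hw1 : ∀ k : ℤ, w1 ≠ k) (hw2 : ∀ k : ℤ, w2 ≠ k)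
    (hw12 : ∀ k : ℤ, w1 + w2 ≠ k) (hw12' : ∀ k : ℤ, w1 - w2 ≠ k)
    (m t : ℕ) (hpar : m % 2 = t % 2) (hnz : ¬(m = 0 ∧ t = 0))
    (e1 e2 h1 h2 : ℝ)
    (he1 : e1 = 1 ∨ e1 = -1) (he2 : e2 = 1 ∨ e2 = -1)
    (hh1 : h1 = 1 ∨ h1 = -1) (hh2 : h2 = 1 ∨ h2 = -1)
    (heq : q ^ (-(m : ℝ) + e1 * w1 + e2 * w2) + q ^ ((m : ℝ) - e1 * w1 - e2 * w2)
         = q ^ (-(t : ℝ) + h1 * w1 + h2 * w2) + q ^ ((t : ℝ) - h1 * w1 - h2 * w2)) :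
    m = t ∧ e1 = h1 ∧ e2 = h2 := by
  have sign_neg {h : ℝ} (hh : h = 1 ∨ h = -1) : -h = 1 ∨ -h = -1 := by
    rcases hh with rfl | rfl <;> simp
  rw [show (m : ℝ) - e1 * w1 - e2 * w2 = -(-(m : ℝ) + e1 * w1 + e2 * w2) by ring,
    show (t : ℝ) - h1 * w1 - h2 * w2 = -(-(t : ℝ) + h1 * w1 + h2 * w2) by ring] at heq
  rcases eq_or_eq_neg_of_rpow_add_rpow_neg_eq hq0 hq1 heq with h | h
  · obtain ⟨k, hk⟩ : ∃ k : ℤ, (m : ℤ) - t = 2 * k := ⟨((m : ℤ) - t) / 2, by omega⟩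
    have hk : (m : ℝ) - t = 2 * k := by exact_mod_cast hk
    obtain ⟨rfl, rfl⟩ := signs_eq_of_signed_sum_sub_eq_even hw1 hw2 hw12 hw12'
      he1 he2 hh1 hh2 k (by linarith)
    have hmt : (m : ℝ) = t := by linarith
    exact ⟨by exact_mod_cast hmt, rfl, rfl⟩
  · obtain ⟨k, hk⟩ : ∃ k : ℤ, (m : ℤ) + t = 2 * k := ⟨((m : ℤ) + t) / 2, by omega⟩
    have hk : (m : ℝ) + t = 2 * k := by exact_mod_cast hk
    obtain ⟨rfl, rfl⟩ := signs_eq_of_signed_sum_sub_eq_even hw1 hw2 hw12 hw12'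
      he1 he2 (sign_neg hh1) (sign_neg hh2) k (by linarith)
    have hmt : (m : ℝ) + t = 0 := by linarith
    have hmt : m + t = 0 := by exact_mod_cast hmt
    omega
end

section
/- Let q ∈ ℂ with q ≠ 0 and q² ≠ 1, and let w₁, w₂ ∈ ℤ with [w₁+1] ≠ 0 and [w₂+1] ≠ 0. Set δ = [2], δ_L = [w₁]/[w₁+1], δ_R = [w₂]/[w₂+1], κ_L = κ_R = 1. Then the determinant of the 6×6 complex matrix with rows (δ_L²δ_Rκ_L, δ_Lδ_Rκ_L, δ_L²δ_R, 0, 0, 0), (δ_Lδ_Rκ_L, δ_Lδ_Rδ, δ_Lδ_R, 0, 0, 0), (δ_L²δ_R, δ_Lδ_R, δ_Lδ_Rδ, δ_Lδ_R, 0, 0), (0, 0, δ_Lδ_R, δ_Lδ_Rδ, δ_Lδ_R, δ_Lδ_R²), (0, 0, 0, δ_Lδ_R, δ_Lδ_Rδ, δ_Lδ_Rκ_R), (0, 0, 0, δ_Lδ_R², δ_Lδ_Rκ_R, δ_Lδ_R²κ_R) equals ([w₁]⁶[w₂]⁶ / ([w₁+1]⁸[w₂+1]⁸)) · [w₁−1]·[w₂−1]·[w₁+w₂+3].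 -/
/-- The quantum integer `[m] = (q^m - q^{-m})/(q - q⁻¹)`. -/
noncomputable def qint (q : ℂ) (m : ℤ) : ℂ := (q ^ m - q ^ (-m)) / (q - q⁻¹)

theorem qint_two_mul {q : ℂ} (hq : q ≠ 0) (hq2 : q ^ 2 ≠ 1) (m : ℤ) :
    qint q 2 * qint q m = qint q (m + 1) + qint q (m - 1) := by
  have hd : q ^ 2 - 1 ≠ 0 := sub_ne_zero.mpr hq2
  have hx : q ^ m ≠ 0 := zpow_ne_zero m hq
  simp only [qint, neg_add, neg_sub, zpow_add₀ hq, zpow_sub₀ hq, zpow_neg, zpow_ofNat]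
  field_simp
  ring

/-- The case `k = 1` of `[m + k][n + k] - [m][n] = [k][m + n + k]`. -/
theorem qint_succ_mul_succ_sub {q : ℂ} (hq : q ≠ 0) (hq2 : q ^ 2 ≠ 1) (m n : ℤ) :
    qint q (m + 1) * qint q (n + 1) - qint q m * qint q n = qint q (m + n + 1) := by
  have hd : q ^ 2 - 1 ≠ 0 := sub_ne_zero.mpr hq2
  have hx : q ^ m ≠ 0 := zpow_ne_zero m hq
  have hy : q ^ n ≠ 0 := zpow_ne_zero n hq
  simp only [qint, neg_add, zpow_add₀ hq, zpow_neg, zpow_one]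
  field_simp
  ring

/-- The Gram matrix with the common factor `δ_L δ_R` removed from its rows, at `κ_L = κ_R = 1`. -/
theorem det_reduced_gram (d a b : ℂ) :
    (Matrix.of
      ![![a, 1, a, 0, 0, 0],
        ![1, d, 1, 0, 0, 0],
        ![a, 1, d, 1, 0, 0],
        ![0, 0, 1, d, 1, b],
        ![0, 0, 0, 1, d, 1],
        ![0, 0, 0, b, 1, b]]).det
    = (d * a - 1) * (d * b - 1) * ((d - a) * (d - b) - 1) := by
  simp [Matrix.det_succ_row_zero, Fin.sum_univ_succ, Fin.succAbove]
  ring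

/-- With `δ = [2]` and `a = [w]/[w+1]`, the factor `δ a - 1` is `[w-1]/[w+1]`. -/
theorem qint_two_mul_div_sub_one {q : ℂ} (hq : q ≠ 0) (hq2 : q ^ 2 ≠ 1) {w : ℤ}
    (hw : qint q (w + 1) ≠ 0) :
    qint q 2 * (qint q w / qint q (w + 1)) - 1 = qint q (w - 1) / qint q (w + 1) := by
  field_simp
  linear_combination qint_two_mul hq hq2 w

/-- With `δ = [2]` and `a = [w]/[w+1]`, the factor `δ - a` is `[w+2]/[w+1]`. -/
theorem qint_two_sub_div {q : ℂ} (hq : q ≠ 0) (hq2 : q ^ 2 ≠ 1) {w : ℤ}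
    (hw : qint q (w + 1) ≠ 0) :
    qint q 2 - qint q w / qint q (w + 1) = qint q (w + 1 + 1) / qint q (w + 1) := by
  have h := qint_two_mul hq hq2 (w + 1)
  rw [add_sub_cancel_right] at h
  field_simp
  linear_combination h

/-- the Gram determinant of the cell module `W^{(5,2)}_{−,−}` in the
standard diagram basis, with `δ = [2]`, `δ_L = [w₁]/[w₁+1]`, `δ_R = [w₂]/[w₂+1]`,
`κ_L = κ_R = 1`, equals
`([w₁]⁶[w₂]⁶/([w₁+1]⁸[w₂+1]⁸))·[w₁−1]·[w₂−1]·[w₁+w₂+3]`. -/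
theorem gram_det_W52 (q : ℂ) (hq : q ≠ 0) (hq2 : q ^ 2 ≠ 1) (w1 w2 : ℤ)
    (hw1 : qint q (w1 + 1) ≠ 0) (hw2 : qint q (w2 + 1) ≠ 0)
    (δ δL δR κL κR : ℂ)
    (hδ : δ = qint q 2)
    (hδL : δL = qint q w1 / qint q (w1 + 1))
    (hδR : δR = qint q w2 / qint q (w2 + 1))
    (hκL : κL = 1) (hκR : κR = 1) :
    (Matrix.of
      ![![δL ^ 2 * δR * κL, δL * δR * κL, δL ^ 2 * δR, 0, 0, 0],
        ![δL * δR * κL, δL * δR * δ, δL * δR, 0, 0, 0],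
        ![δL ^ 2 * δR, δL * δR, δL * δR * δ, δL * δR, 0, 0],
        ![0, 0, δL * δR, δL * δR * δ, δL * δR, δL * δR ^ 2],
        ![0, 0, 0, δL * δR, δL * δR * δ, δL * δR * κR],
        ![0, 0, 0, δL * δR ^ 2, δL * δR * κR, δL * δR ^ 2 * κR]]).det
    = (qint q w1 ^ 6 * qint q w2 ^ 6 / (qint q (w1 + 1) ^ 8 * qint q (w2 + 1) ^ 8))
        * qint q (w1 - 1) * qint q (w2 - 1) * qint q (w1 + w2 + 3) := by
  subst hκL hκR
  have hfactor : (Matrix.of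
      ![![δL ^ 2 * δR * 1, δL * δR * 1, δL ^ 2 * δR, 0, 0, 0],
        ![δL * δR * 1, δL * δR * δ, δL * δR, 0, 0, 0],
        ![δL ^ 2 * δR, δL * δR, δL * δR * δ, δL * δR, 0, 0],
        ![0, 0, δL * δR, δL * δR * δ, δL * δR, δL * δR ^ 2],
        ![0, 0, 0, δL * δR, δL * δR * δ, δL * δR * 1],
        ![0, 0, 0, δL * δR ^ 2, δL * δR * 1, δL * δR ^ 2 * 1]])
      = (δL * δR) • Matrix.of
      ![![δL, 1, δL, 0, 0, 0],
        ![1, δ, 1, 0, 0, 0],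
        ![δL, 1, δ, 1, 0, 0],
        ![0, 0, 1, δ, 1, δR],
        ![0, 0, 0, 1, δ, 1],
        ![0, 0, 0, δR, 1, δR]] := by
    ext i j
    fin_cases i <;> fin_cases j <;> simp <;> ring
  have hsum := qint_succ_mul_succ_sub hq hq2 (w1 + 1) (w2 + 1)
  rw [show w1 + 1 + (w2 + 1) + 1 = w1 + w2 + 3 by ring] at hsum
  rw [hfactor, Matrix.det_smul, det_reduced_gram, Fintype.card_fin]
  change (δL * δR) ^ 6 * _ = _
  rw [hδ, hδL, hδR, qint_two_mul_div_sub_one hq hq2 hw1, qint_two_mul_div_sub_one hq hq2 hw2,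
    qint_two_sub_div hq hq2 hw1, qint_two_sub_div hq hq2 hw2, ← hsum]
  field_simp
end

section
/- In the Hecke algebra H(C̃_n) (defined in the context), the Murphy elements J₀, J₁, …, J_{n−1} pairwise commute: J_i·J_j = J_j·J_i for all 0 ≤ i, j ≤ n−1. Moreover: g₀ commutes with J_j for every j ≠ 0; g_i commutes with J_j for every 1 ≤ i ≤ n−1 and j ∉ {i−1, i}; g_i commutes with J_{i−1}·J_i and with J_{i−1} + J_i for every 1 ≤ i ≤ n−1; and g₀ commutes with J₀ + J₀⁻¹. -/
noncomputable section

open scoped BigOperators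

/-- The defining relations of the Hecke algebra `H(C̃ₙ)` of type `C̃ₙ`, imposed on the
free associative ℂ-algebra on generators `g₀, …, gₙ` (indexed by `Fin (n+1)`). -/
inductive HeckeRel (n : ℕ) (q Q1 Q2 : ℂ) :
    FreeAlgebra ℂ (Fin (n + 1)) → FreeAlgebra ℂ (Fin (n + 1)) → Prop
  /-- braid relation `gᵢg_{i+1}gᵢ = g_{i+1}gᵢg_{i+1}` for `1 ≤ i ≤ n−2` -/
  | braid (i : ℕ) (h1 : 1 ≤ i) (h2 : i + 2 ≤ n) :
      HeckeRel n q Q1 Q2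
        (FreeAlgebra.ι ℂ (⟨i, by omega⟩ : Fin (n + 1)) *
          FreeAlgebra.ι ℂ (⟨i + 1, by omega⟩ : Fin (n + 1)) *
          FreeAlgebra.ι ℂ (⟨i, by omega⟩ : Fin (n + 1)))
        (FreeAlgebra.ι ℂ (⟨i + 1, by omega⟩ : Fin (n + 1)) *
          FreeAlgebra.ι ℂ (⟨i, by omega⟩ : Fin (n + 1)) *
          FreeAlgebra.ι ℂ (⟨i + 1, by omega⟩ : Fin (n + 1)))
  /-- `g₀g₁g₀g₁ = g₁g₀g₁g₀` -/
  | braid0 (h : 1 ≤ n) :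
      HeckeRel n q Q1 Q2
        (FreeAlgebra.ι ℂ (⟨0, by omega⟩ : Fin (n + 1)) *
          FreeAlgebra.ι ℂ (⟨1, by omega⟩ : Fin (n + 1)) *
          FreeAlgebra.ι ℂ (⟨0, by omega⟩ : Fin (n + 1)) *
          FreeAlgebra.ι ℂ (⟨1, by omega⟩ : Fin (n + 1)))
        (FreeAlgebra.ι ℂ (⟨1, by omega⟩ : Fin (n + 1)) *
          FreeAlgebra.ι ℂ (⟨0, by omega⟩ : Fin (n + 1)) *
          FreeAlgebra.ι ℂ (⟨1, by omega⟩ : Fin (n + 1)) *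
          FreeAlgebra.ι ℂ (⟨0, by omega⟩ : Fin (n + 1)))
  /-- `g_{n−1}gₙg_{n−1}gₙ = gₙg_{n−1}gₙg_{n−1}` -/
  | braidn (h : 1 ≤ n) :
      HeckeRel n q Q1 Q2
        (FreeAlgebra.ι ℂ (⟨n - 1, by omega⟩ : Fin (n + 1)) *
          FreeAlgebra.ι ℂ (⟨n, by omega⟩ : Fin (n + 1)) *
          FreeAlgebra.ι ℂ (⟨n - 1, by omega⟩ : Fin (n + 1)) *
          FreeAlgebra.ι ℂ (⟨n, by omega⟩ : Fin (n + 1)))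
        (FreeAlgebra.ι ℂ (⟨n, by omega⟩ : Fin (n + 1)) *
          FreeAlgebra.ι ℂ (⟨n - 1, by omega⟩ : Fin (n + 1)) *
          FreeAlgebra.ι ℂ (⟨n, by omega⟩ : Fin (n + 1)) *
          FreeAlgebra.ι ℂ (⟨n - 1, by omega⟩ : Fin (n + 1)))
  /-- commuting relation `gᵢgⱼ = gⱼgᵢ` for `|i − j| > 1` -/
  | comm (i j : ℕ) (hij : i + 1 < j) (hj : j ≤ n) :
      HeckeRel n q Q1 Q2
        (FreeAlgebra.ι ℂ (⟨i, by omega⟩ : Fin (n + 1)) *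
          FreeAlgebra.ι ℂ (⟨j, by omega⟩ : Fin (n + 1)))
        (FreeAlgebra.ι ℂ (⟨j, by omega⟩ : Fin (n + 1)) *
          FreeAlgebra.ι ℂ (⟨i, by omega⟩ : Fin (n + 1)))
  /-- quadratic relation `(gᵢ − q)(gᵢ + q⁻¹) = 0` for `1 ≤ i ≤ n−1` -/
  | quad (i : ℕ) (h1 : 1 ≤ i) (h2 : i + 1 ≤ n) :
      HeckeRel n q Q1 Q2
        ((FreeAlgebra.ι ℂ (⟨i, by omega⟩ : Fin (n + 1)) -
            algebraMap ℂ (FreeAlgebra ℂ (Fin (n + 1))) q) *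
          (FreeAlgebra.ι ℂ (⟨i, by omega⟩ : Fin (n + 1)) +
            algebraMap ℂ (FreeAlgebra ℂ (Fin (n + 1))) q⁻¹))
        0
  /-- quadratic relation `(g₀ − Q₁)(g₀ + Q₁⁻¹) = 0` -/
  | quad0 :
      HeckeRel n q Q1 Q2
        ((FreeAlgebra.ι ℂ (⟨0, by omega⟩ : Fin (n + 1)) -
            algebraMap ℂ (FreeAlgebra ℂ (Fin (n + 1))) Q1) *
          (FreeAlgebra.ι ℂ (⟨0, by omega⟩ : Fin (n + 1)) +
            algebraMap ℂ (FreeAlgebra ℂ (Fin (n + 1))) Q1⁻¹))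
        0
  /-- quadratic relation `(gₙ − Q₂)(gₙ + Q₂⁻¹) = 0` -/
  | quadn :
      HeckeRel n q Q1 Q2
        ((FreeAlgebra.ι ℂ (⟨n, by omega⟩ : Fin (n + 1)) -
            algebraMap ℂ (FreeAlgebra ℂ (Fin (n + 1))) Q2) *
          (FreeAlgebra.ι ℂ (⟨n, by omega⟩ : Fin (n + 1)) +
            algebraMap ℂ (FreeAlgebra ℂ (Fin (n + 1))) Q2⁻¹))
        0

/-- The Hecke algebra `H(C̃ₙ)`: the quotient of the free associative ℂ-algebra on
`g₀, …, gₙ` by the two-sided ideal generated by the defining relations. -/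
abbrev HeckeC (n : ℕ) (q Q1 Q2 : ℂ) := RingQuot (HeckeRel n q Q1 Q2)

/-- The generator `gᵢ` of `H(C̃ₙ)` (taking the junk value `0` when `i > n`). -/
def HG (n : ℕ) (q Q1 Q2 : ℂ) (i : ℕ) : HeckeC n q Q1 Q2 :=
  if h : i < n + 1 then
    RingQuot.mkAlgHom ℂ (HeckeRel n q Q1 Q2) (FreeAlgebra.ι ℂ (⟨i, h⟩ : Fin (n + 1)))
  else 0

/-- The Murphy elements: `J₀ = g₁⁻¹g₂⁻¹⋯g_{n−1}⁻¹ · gₙ · g_{n−1}⋯g₂g₁ · g₀` and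
`Jᵢ = gᵢ·J_{i−1}·gᵢ`.  (Each generator is a unit, so `Ring.inverse` is its inverse.) -/
def HJ (n : ℕ) (q Q1 Q2 : ℂ) : ℕ → HeckeC n q Q1 Q2
  | 0 =>
      ((List.range (n - 1)).map (fun k => Ring.inverse (HG n q Q1 Q2 (k + 1)))).prod *
        HG n q Q1 Q2 n *
        (((List.range (n - 1)).map (fun k => HG n q Q1 Q2 (k + 1))).reverse).prod *
        HG n q Q1 Q2 0
  | (i + 1) => HG n q Q1 Q2 (i + 1) * HJ n q Q1 Q2 i * HG n q Q1 Q2 (i + 1)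


/-- The braid relations of type `C̃ₙ` for a family of elements of a group. -/
structure IsBraidC {G : Type*} [Group G] (n : ℕ) (g : ℕ → G) : Prop where
  braid : ∀ i, 1 ≤ i → i + 2 ≤ n → g i * g (i + 1) * g i = g (i + 1) * g i * g (i + 1)
  braid_zero : g 0 * g 1 * g 0 * g 1 = g 1 * g 0 * g 1 * g 0
  braid_last : g (n - 1) * g n * g (n - 1) * g n = g n * g (n - 1) * g n * g (n - 1)
  comm : ∀ i j, i + 1 < j → j ≤ n → Commute (g i) (g j)

namespace IsBraidC

variable {G : Type*} [Group G]

/-- The descending product `g k * ⋯ * g 1`. -/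
def desc (g : ℕ → G) : ℕ → G
  | 0 => 1
  | k + 1 => g (k + 1) * desc g k

/-- The element `(g (k+1))⁻¹ ⋯ (g (n-1))⁻¹ * g n * g (n-1) ⋯ g (k+1)`, obtained by
conjugating upwards from `k = 0`. -/
def left (n : ℕ) (g : ℕ → G) : ℕ → G
  | 0 => (desc g (n - 1))⁻¹ * g n * desc g (n - 1)
  | k + 1 => g (k + 1) * left n g k * (g (k + 1))⁻¹

/-- The palindromic element `g k ⋯ g 1 * g 0 * g 1 ⋯ g k`. -/
def right (g : ℕ → G) : ℕ → G
  | 0 => g 0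
  | k + 1 => g (k + 1) * right g k * g (k + 1)

/-- The Murphy elements in the group. -/
def murphy (n : ℕ) (g : ℕ → G) : ℕ → G
  | 0 => (desc g (n - 1))⁻¹ * g n * desc g (n - 1) * g 0
  | k + 1 => g (k + 1) * murphy n g k * g (k + 1)

lemma murphy_eq (n : ℕ) (g : ℕ → G) (k : ℕ) : murphy n g k = left n g k * right g k := by
  induction k with
  | zero => rfl
  | succ k ih => simp only [murphy, left, right, ih]; group

lemma left_eq_conj (n : ℕ) (g : ℕ → G) (k : ℕ) :
    left n g k = desc g k * left n g 0 * (desc g k)⁻¹ := by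
  induction k with
  | zero => simp [desc]
  | succ k ih => simp only [left.eq_2, desc, ih]; group

lemma left_last (n : ℕ) (g : ℕ → G) : left n g (n - 1) = g n := by
  rw [left_eq_conj, left]; group

lemma left_eq_succ (n : ℕ) (g : ℕ → G) (k : ℕ) :
    left n g k = (g (k + 1))⁻¹ * left n g (k + 1) * g (k + 1) := by
  rw [left]; group

variable {n : ℕ} {g : ℕ → G}

/-- Induction downwards from `n - 1`. -/
lemma left_induction {motive : ℕ → Prop} (last : motive (n - 1))
    (step : ∀ k, k + 1 ≤ n - 1 → motive (k + 1) → motive k) {k : ℕ} (hk : k ≤ n - 1) :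
    motive k := by
  induction hk using Nat.decreasingInduction with
  | self => exact last
  | of_succ k hk ih => exact step k hk ih

lemma left_comm_lt (h : IsBraidC n g) {k : ℕ} (hk : k ≤ n - 1) :
    ∀ i, i < k → Commute (left n g k) (g i) := by
  refine left_induction (motive := fun k => ∀ i, i < k → Commute (left n g k) (g i)) ?_ ?_ hk
  · intro i hi
    rw [left_last]
    exact (h.comm i n (by omega) le_rfl).symm
  · intro k hk ih i hi
    have hc : Commute (g (k + 1)) (g i) := (h.comm i (k + 1) (by omega) (by omega)).symm
    rw [left_eq_succ]
    exact (hc.inv_left.mul_left (ih i (by omega))).mul_left hc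

lemma left_comm_gt (h : IsBraidC n g) {k : ℕ} (hk : k ≤ n - 1) :
    ∀ i, k + 2 ≤ i → i ≤ n - 1 → Commute (left n g k) (g i) := by
  refine left_induction
    (motive := fun k => ∀ i, k + 2 ≤ i → i ≤ n - 1 → Commute (left n g k) (g i)) ?_ ?_ hk
  · intro i hi hi'
    omega
  · intro k hk ih i hi hi'
    obtain rfl | hi := hi.eq_or_lt
    · have hx : Commute (left n g (k + 2)) (g (k + 1)) := h.left_comm_lt hi' _ (by omega)
      have hb := h.braid (k + 1) (by omega) (by omega)
      rw [left_eq_succ, left_eq_succ]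
      have hs : SemiconjBy (g (k + 2) * g (k + 1)) (g (k + 2)) (g (k + 1)) := by
        simpa [SemiconjBy, mul_assoc] using hb.symm
      have hs' := (hs.inv_symm_left.mul_left hx).mul_left hs
      simpa only [Commute, mul_inv_rev, mul_assoc] using hs'
    · have hc : Commute (g (k + 1)) (g i) := h.comm (k + 1) i (by omega) (by omega)
      rw [left_eq_succ]
      exact (hc.inv_left.mul_left (ih i (by omega) hi')).mul_left hc

lemma right_comm_gt (h : IsBraidC n g) (k i : ℕ) (hi : k + 2 ≤ i) (hi' : i ≤ n) :
    Commute (right g k) (g i) := by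
  induction k with
  | zero => exact h.comm 0 i (by omega) hi'
  | succ k ih =>
    have hc : Commute (g (k + 1)) (g i) := h.comm (k + 1) i (by omega) hi'
    exact (hc.mul_left (ih (by omega))).mul_left hc

lemma right_comm_lt (h : IsBraidC n g) {k : ℕ} (hk : k ≤ n - 1) (i : ℕ) (hi : i < k) :
    Commute (right g k) (g i) := by
  induction k with
  | zero => omega
  | succ k ih =>
    obtain rfl | hi := (Nat.lt_succ_iff.mp hi).eq_or_lt
    · cases i with
      | zero =>
        have hb := h.braid_zero
        simp only [right, Commute, SemiconjBy, zero_add, mul_assoc] at hb ⊢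
        exact hb.symm
      | succ i =>
        have hb : g (i + 1) * g (i + 2) * g (i + 1) = g (i + 2) * g (i + 1) * g (i + 2) :=
          h.braid (i + 1) (by omega) (by omega)
        have hy : Commute (right g i) (g (i + 2)) := h.right_comm_gt i _ le_rfl (by omega)
        calc g (i + 2) * (g (i + 1) * right g i * g (i + 1)) * g (i + 2) * g (i + 1)
            = g (i + 2) * g (i + 1) * right g i * (g (i + 1) * g (i + 2) * g (i + 1)) := by
              simp only [mul_assoc]
          _ = g (i + 2) * g (i + 1) * (right g i * g (i + 2)) * g (i + 1) * g (i + 2) := by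
              rw [hb]; simp only [mul_assoc]
          _ = (g (i + 2) * g (i + 1) * g (i + 2)) * right g i * g (i + 1) * g (i + 2) := by
              rw [hy.eq]; simp only [mul_assoc]
          _ = g (i + 1) * (g (i + 2) * (g (i + 1) * right g i * g (i + 1)) * g (i + 2)) := by
              rw [← hb]; simp only [mul_assoc]
    · have hc : Commute (g (k + 1)) (g i) := (h.comm i (k + 1) (by omega) (by omega)).symm
      exact (hc.mul_left (ih (by omega) hi)).mul_left hc

lemma murphy_comm_gen (h : IsBraidC n g) {i k : ℕ} (hk : k ≤ n - 1) (hi : i ≤ n - 1)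
    (h1 : i ≠ k) (h2 : i ≠ k + 1) : Commute (murphy n g k) (g i) := by
  rw [murphy_eq]
  obtain hik | hik := lt_or_ge i k
  · exact (h.left_comm_lt hk i hik).mul_left (h.right_comm_lt hk i hik)
  · exact (h.left_comm_gt hk i (by omega) hi).mul_left
      (h.right_comm_gt k i (by omega) (by omega))

lemma commute_right {z : G} {k : ℕ} (hz : ∀ i, i ≤ k → Commute z (g i)) :
    Commute z (right g k) := by
  induction k with
  | zero => exact hz 0 le_rfl
  | succ k ih =>
    exact ((hz _ le_rfl).mul_right (ih fun i hi => hz i (by omega))).mul_right (hz _ le_rfl)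

lemma right_braid (h : IsBraidC n g) {k : ℕ} (hk : k + 1 ≤ n - 1) :
    right g k * g (k + 1) * right g k * g (k + 1) =
      g (k + 1) * right g k * g (k + 1) * right g k := by
  have hc : Commute (right g (k + 1)) (right g k) :=
    commute_right fun i hi => h.right_comm_lt hk i (by omega)
  simpa only [right, Commute, SemiconjBy, mul_assoc] using hc.eq.symm

lemma conj_braid {x a b : G} (hab : a * b * a = b * a * b) (hxa : Commute x a)
    (hxb : x * b * x * b = b * x * b * x) :
    (b⁻¹ * x * b) * a * (b⁻¹ * x * b) * a = a * (b⁻¹ * x * b) * a * (b⁻¹ * x * b) := by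
  have h1 : b * a * b⁻¹ = a⁻¹ * b * a := by
    calc b * a * b⁻¹ = a⁻¹ * (a * b * a) * b⁻¹ := by group
      _ = a⁻¹ * b * a := by rw [hab]; group
  have h2 : a * b⁻¹ * a⁻¹ = b⁻¹ * a⁻¹ * b := by
    calc a * b⁻¹ * a⁻¹ = b⁻¹ * a⁻¹ * (a * b * a) * b⁻¹ * a⁻¹ := by group
      _ = b⁻¹ * a⁻¹ * b := by rw [hab]; group
  have hx' : x * a⁻¹ = a⁻¹ * x := hxa.inv_right.eq
  calc (b⁻¹ * x * b) * a * (b⁻¹ * x * b) * a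
      = b⁻¹ * x * (b * a * b⁻¹) * x * b * a := by group
    _ = b⁻¹ * (x * a⁻¹) * b * (a * x) * b * a := by rw [h1]; simp only [mul_assoc]
    _ = b⁻¹ * a⁻¹ * x * b * x * (a * b * a) := by
        rw [hx', ← hxa.eq]; simp only [mul_assoc]
    _ = b⁻¹ * a⁻¹ * (x * b * x * b) * a * b := by rw [hab]; simp only [mul_assoc]
    _ = (b⁻¹ * a⁻¹ * b) * x * b * (x * a) * b := by rw [hxb]; simp only [mul_assoc]
    _ = a * b⁻¹ * (a⁻¹ * x) * b * (a * x) * b := by rw [← h2, hxa.eq]; simp only [mul_assoc]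
    _ = a * b⁻¹ * x * (a⁻¹ * b * a) * x * b := by rw [← hx']; simp only [mul_assoc]
    _ = a * (b⁻¹ * x * b) * a * (b⁻¹ * x * b) := by rw [← h1]; simp only [mul_assoc]

lemma left_braid (h : IsBraidC n g) {k : ℕ} (hk : k ≤ n - 1) (hk1 : 1 ≤ k) :
    left n g k * g k * left n g k * g k = g k * left n g k * g k * left n g k := by
  refine left_induction (motive := fun k => 1 ≤ k →
    left n g k * g k * left n g k * g k = g k * left n g k * g k * left n g k) ?_ ?_ hk hk1
  · intro _
    rw [left_last]
    exact h.braid_last.symm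
  · intro k hk ih hk1
    rw [left_eq_succ]
    exact conj_braid (h.braid k hk1 (by omega)) (h.left_comm_lt hk k (by omega)) (ih (by omega))

lemma murphy_comm_succ (h : IsBraidC n g) {k : ℕ} (hk : k + 1 ≤ n - 1) :
    Commute (murphy n g k) (murphy n g (k + 1)) := by
  have hxy : Commute (left n g (k + 1)) (right g k) :=
    commute_right fun i hi => h.left_comm_lt hk i (by omega)
  have hX := h.left_braid hk (by omega)
  have hY := h.right_braid hk
  rw [murphy_eq, murphy_eq, left_eq_succ, right]
  set x := left n g (k + 1)
  set y := right g k
  set a := g (k + 1)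
  calc a⁻¹ * x * a * y * (x * (a * y * a))
      = a⁻¹ * x * a * (y * x) * a * y * a := by simp only [mul_assoc]
    _ = a⁻¹ * x * a * x * (y * a * y * a) := by rw [← hxy.eq]; simp only [mul_assoc]
    _ = a⁻¹ * (x * a * x * a) * y * a * y := by rw [hY]; simp only [mul_assoc]
    _ = x * a * (x * y) * a * y := by rw [hX]; group
    _ = x * (a * y * a) * (a⁻¹ * x * a * y) := by rw [hxy.eq]; group

lemma murphy_comm_of_lt (h : IsBraidC n g) {j k : ℕ} (hjk : j + 1 ≤ k) (hk : k ≤ n - 1) :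
    Commute (murphy n g j) (murphy n g k) := by
  induction k, hjk using Nat.le_induction with
  | base => exact h.murphy_comm_succ hk
  | succ k hjk ih =>
    have hc := h.murphy_comm_gen (i := k + 1) (k := j) (by omega) hk (by omega) (by omega)
    exact (hc.mul_right (ih (by omega))).mul_right hc

lemma murphy_comm (h : IsBraidC n g) {j k : ℕ} (hj : j ≤ n - 1) (hk : k ≤ n - 1) :
    Commute (murphy n g j) (murphy n g k) := by
  obtain hjk | rfl | hjk := lt_trichotomy j k
  · exact h.murphy_comm_of_lt hjk hk
  · exact Commute.refl _
  · exact (h.murphy_comm_of_lt hjk hj).symm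

end IsBraidC

section Ring

variable {R : Type*} [Ring R]

lemma mul_sub_algebraMap_eq_one [Algebra ℂ R] {x : R} {c : ℂ} (hc : c ≠ 0)
    (h : (x - algebraMap ℂ R c) * (x + algebraMap ℂ R c⁻¹) = 0) :
    x * (x - algebraMap ℂ R (c - c⁻¹)) = 1 := by
  have h1 : algebraMap ℂ R c * algebraMap ℂ R c⁻¹ = 1 := by
    rw [← map_mul, mul_inv_cancel₀ hc, map_one]
  have h2 := Algebra.commutes c x
  rw [sub_mul, mul_add, mul_add, h1, h2] at h
  rw [map_sub, mul_sub, mul_sub, ← sub_eq_zero, ← h]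
  abel

/-- An invertible element satisfying a quadratic Hecke relation, as a unit. -/
def heckeUnit [Algebra ℂ R] (x : R) (c : ℂ) (h : x * (x - algebraMap ℂ R (c - c⁻¹)) = 1) : Rˣ where
  val := x
  inv := x - algebraMap ℂ R (c - c⁻¹)
  val_inv := h
  inv_val := by rw [← h, sub_mul, mul_sub, Algebra.commutes]

lemma commute_add_conj {x y a : R} (hx : x * x = 1 + a * x) (ha : ∀ z, Commute a z) :
    x * (y + x * y * x) = (y + x * y * x) * x := by
  have h1 : x * (y + x * y * x) = x * y + x * x * (y * x) := by noncomm_ring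
  have h2 : (y + x * y * x) * x = y * x + x * y * (x * x) := by noncomm_ring
  have h3 : x * y * (a * x) = a * x * (y * x) := by
    rw [← mul_assoc, ← (ha (x * y)).eq]; noncomm_ring
  rw [h1, h2, hx, add_mul, mul_add, h3]
  noncomm_ring

lemma commute_mul_add_inv {x y x' y' a b : R} (hx : x * x' = 1) (hx' : x' = x - a)
    (hy' : y' = y - b) (ha : ∀ z, Commute a z) (hb : ∀ z, Commute b z) :
    x * (y * x + x' * y') = (y * x + x' * y') * x := by
  have h2 : x * x = 1 + a * x := by
    rw [hx', mul_sub, sub_eq_iff_eq_add, ← (ha x).eq] at hx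
    exact hx
  have h3 : y * (a * x) = a * y * x := by rw [← mul_assoc, ← (ha y).eq]
  have h4 : x * b * x = b * (x * x) := by rw [← (hb x).eq, mul_assoc]
  have h5 : a * b * x = b * (a * x) := by rw [(ha b).eq, mul_assoc]
  have hl : x * (y * x + x' * y') = x * y * x + x * x' * y' := by noncomm_ring
  have hr : (y * x + x' * y') * x = y * (x * x) + x' * y' * x := by noncomm_ring
  have hm : x' * y' * x = x * y * x - a * y * x - x * b * x + a * b * x := by
    rw [hx', hy']; noncomm_ring
  rw [hl, hr, hx, hm, h4, h5, h2, mul_add, h3, hy']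
  noncomm_ring

end Ring

section Hecke

variable {n : ℕ} {q Q1 Q2 : ℂ}

lemma HG_of_le {i : ℕ} (hi : i ≤ n) : HG n q Q1 Q2 i =
    RingQuot.mkAlgHom ℂ (HeckeRel n q Q1 Q2) (FreeAlgebra.ι ℂ ⟨i, Nat.lt_succ_of_le hi⟩) :=
  dif_pos (Nat.lt_succ_of_le hi)

/-- The parameter of the quadratic relation of `gᵢ`. -/
def heckeParam (n : ℕ) (q Q1 Q2 : ℂ) (i : ℕ) : ℂ :=
  if i = 0 then Q1 else if i = n then Q2 else q

lemma HG_quad (hn : 2 ≤ n) (hq : q ≠ 0) (hQ1 : Q1 ≠ 0) (hQ2 : Q2 ≠ 0) {i : ℕ} (hi : i ≤ n) :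
    HG n q Q1 Q2 i * (HG n q Q1 Q2 i - algebraMap ℂ (HeckeC n q Q1 Q2)
      (heckeParam n q Q1 Q2 i - (heckeParam n q Q1 Q2 i)⁻¹)) = 1 := by
  have key : ∀ c : ℂ, c ≠ 0 → HeckeRel n q Q1 Q2
      ((FreeAlgebra.ι ℂ (⟨i, Nat.lt_succ_of_le hi⟩ : Fin (n + 1)) - algebraMap ℂ _ c) *
        (FreeAlgebra.ι ℂ (⟨i, Nat.lt_succ_of_le hi⟩ : Fin (n + 1)) + algebraMap ℂ _ c⁻¹)) 0 →
      HG n q Q1 Q2 i * (HG n q Q1 Q2 i - algebraMap ℂ (HeckeC n q Q1 Q2) (c - c⁻¹)) = 1 := by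
    intro c hc hr
    apply mul_sub_algebraMap_eq_one hc
    have := RingQuot.mkAlgHom_rel ℂ hr
    simpa only [HG_of_le hi, map_mul, map_sub, map_add, map_zero, AlgHom.commutes] using this
  unfold heckeParam
  split_ifs with h0 h1
  · subst h0; exact key _ hQ1 .quad0
  · subst h1; exact key _ hQ2 .quadn
  · exact key _ hq (.quad i (by omega) (by omega))

open Classical in
/-- The generators as units of the Hecke algebra. -/
def heckeGen (n : ℕ) (q Q1 Q2 : ℂ) (i : ℕ) : (HeckeC n q Q1 Q2)ˣ :=
  if h : HG n q Q1 Q2 i * (HG n q Q1 Q2 i - algebraMap ℂ (HeckeC n q Q1 Q2)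
      (heckeParam n q Q1 Q2 i - (heckeParam n q Q1 Q2 i)⁻¹)) = 1
  then heckeUnit _ _ h else 1

lemma heckeGen_val (hn : 2 ≤ n) (hq : q ≠ 0) (hQ1 : Q1 ≠ 0) (hQ2 : Q2 ≠ 0) {i : ℕ}
    (hi : i ≤ n) : (heckeGen n q Q1 Q2 i : HeckeC n q Q1 Q2) = HG n q Q1 Q2 i := by
  rw [heckeGen, dif_pos (HG_quad hn hq hQ1 hQ2 hi)]; rfl

lemma heckeGen_inv (hn : 2 ≤ n) (hq : q ≠ 0) (hQ1 : Q1 ≠ 0) (hQ2 : Q2 ≠ 0) {i : ℕ}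
    (hi : i ≤ n) : ((heckeGen n q Q1 Q2 i)⁻¹ : (HeckeC n q Q1 Q2)ˣ).val =
      HG n q Q1 Q2 i - algebraMap ℂ (HeckeC n q Q1 Q2)
        (heckeParam n q Q1 Q2 i - (heckeParam n q Q1 Q2 i)⁻¹) := by
  rw [heckeGen, dif_pos (HG_quad hn hq hQ1 hQ2 hi)]; rfl

lemma isBraidC_heckeGen (hn : 2 ≤ n) (hq : q ≠ 0) (hQ1 : Q1 ≠ 0) (hQ2 : Q2 ≠ 0) :
    IsBraidC n (heckeGen n q Q1 Q2) where
  braid i h1 h2 := by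
    ext
    simp only [Units.val_mul]
    rw [heckeGen_val hn hq hQ1 hQ2 (by omega), heckeGen_val hn hq hQ1 hQ2 (by omega),
      HG_of_le (by omega), HG_of_le (by omega)]
    simpa only [map_mul] using RingQuot.mkAlgHom_rel ℂ (HeckeRel.braid (q := q) i h1 h2)
  braid_zero := by
    ext
    simp only [Units.val_mul]
    rw [heckeGen_val hn hq hQ1 hQ2 (by omega), heckeGen_val hn hq hQ1 hQ2 (by omega),
      HG_of_le (by omega), HG_of_le (by omega)]
    simpa only [map_mul] using
      RingQuot.mkAlgHom_rel ℂ (HeckeRel.braid0 (n := n) (q := q) (by omega))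
  braid_last := by
    ext
    simp only [Units.val_mul]
    rw [heckeGen_val hn hq hQ1 hQ2 (by omega), heckeGen_val hn hq hQ1 hQ2 (by omega),
      HG_of_le (by omega), HG_of_le (by omega)]
    simpa only [map_mul] using
      RingQuot.mkAlgHom_rel ℂ (HeckeRel.braidn (n := n) (q := q) (by omega))
  comm i j hij hj := by
    ext
    simp only [Units.val_mul]
    rw [heckeGen_val hn hq hQ1 hQ2 (by omega), heckeGen_val hn hq hQ1 hQ2 (by omega),
      HG_of_le (by omega), HG_of_le (by omega)]
    simpa only [map_mul] using RingQuot.mkAlgHom_rel ℂ (HeckeRel.comm (q := q) i j hij hj)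

lemma desc_heckeGen_val (hn : 2 ≤ n) (hq : q ≠ 0) (hQ1 : Q1 ≠ 0) (hQ2 : Q2 ≠ 0) {m : ℕ}
    (hm : m ≤ n) : (IsBraidC.desc (heckeGen n q Q1 Q2) m).val =
      (((List.range m).map (fun k => HG n q Q1 Q2 (k + 1))).reverse).prod := by
  induction m with
  | zero => simp [IsBraidC.desc]
  | succ m ih =>
    simp [IsBraidC.desc, List.range_succ, ih (by omega), heckeGen_val hn hq hQ1 hQ2 hm]

lemma desc_heckeGen_inv (hn : 2 ≤ n) (hq : q ≠ 0) (hQ1 : Q1 ≠ 0) (hQ2 : Q2 ≠ 0) {m : ℕ}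
    (hm : m ≤ n) :
    ((IsBraidC.desc (heckeGen n q Q1 Q2) m)⁻¹ : (HeckeC n q Q1 Q2)ˣ).val =
      ((List.range m).map (fun k => Ring.inverse (HG n q Q1 Q2 (k + 1)))).prod := by
  induction m with
  | zero => simp [IsBraidC.desc]
  | succ m ih =>
    rw [IsBraidC.desc, mul_inv_rev, Units.val_mul, ih (by omega), List.range_succ,
      List.map_append, List.prod_append, List.map_singleton, List.prod_singleton,
      ← heckeGen_val hn hq hQ1 hQ2 hm, Ring.inverse_unit]

lemma murphy_heckeGen_val (hn : 2 ≤ n) (hq : q ≠ 0) (hQ1 : Q1 ≠ 0) (hQ2 : Q2 ≠ 0) {k : ℕ}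
    (hk : k ≤ n - 1) :
    (IsBraidC.murphy n (heckeGen n q Q1 Q2) k).val = HJ n q Q1 Q2 k := by
  induction k with
  | zero =>
    simp only [IsBraidC.murphy, HJ, Units.val_mul]
    rw [desc_heckeGen_val hn hq hQ1 hQ2 (by omega), desc_heckeGen_inv hn hq hQ1 hQ2 (by omega),
      heckeGen_val hn hq hQ1 hQ2 le_rfl, heckeGen_val hn hq hQ1 hQ2 (by omega)]
  | succ k ih =>
    simp only [IsBraidC.murphy, HJ, Units.val_mul]
    rw [ih (by omega), heckeGen_val hn hq hQ1 hQ2 (by omega)]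

lemma HG_comm_murphy_zero_add_inv (hn : 2 ≤ n) (hq : q ≠ 0) (hQ1 : Q1 ≠ 0) (hQ2 : Q2 ≠ 0) :
    HG n q Q1 Q2 0 * (HJ n q Q1 Q2 0 + Ring.inverse (HJ n q Q1 Q2 0)) =
      (HJ n q Q1 Q2 0 + Ring.inverse (HJ n q Q1 Q2 0)) * HG n q Q1 Q2 0 := by
  rw [← murphy_heckeGen_val hn hq hQ1 hQ2 (Nat.zero_le _), Ring.inverse_unit,
    ← heckeGen_val hn hq hQ1 hQ2 (Nat.zero_le _), IsBraidC.murphy, mul_inv_rev, Units.val_mul,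
    Units.val_mul _⁻¹]
  refine commute_mul_add_inv
    (a := algebraMap ℂ _ (heckeParam n q Q1 Q2 0 - (heckeParam n q Q1 Q2 0)⁻¹))
    (b := algebraMap ℂ _ (heckeParam n q Q1 Q2 n - (heckeParam n q Q1 Q2 n)⁻¹))
    (Units.mul_inv _) ?_ ?_ (Algebra.commutes _) (Algebra.commutes _)
  · rw [heckeGen_inv hn hq hQ1 hQ2 (Nat.zero_le _), heckeGen_val hn hq hQ1 hQ2 (Nat.zero_le _)]
  · set d := IsBraidC.desc (heckeGen n q Q1 Q2) (n - 1)
    have hd : (d⁻¹ * heckeGen n q Q1 Q2 n * d)⁻¹ = d⁻¹ * (heckeGen n q Q1 Q2 n)⁻¹ * d := by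
      group
    rw [hd]
    simp only [Units.val_mul]
    rw [heckeGen_inv hn hq hQ1 hQ2 le_rfl, heckeGen_val hn hq hQ1 hQ2 le_rfl, mul_sub, sub_mul,
      ← Algebra.commutes, mul_assoc (algebraMap _ _ _), Units.inv_mul, mul_one]

end Hecke

/-- the Murphy elements `J₀, …, J_{n−1}` pairwise commute; `g₀` commutes
with `Jⱼ` for `j ≠ 0`; `gᵢ` (for `1 ≤ i ≤ n−1`) commutes with `Jⱼ` for `j ∉ {i−1, i}`,
and with `J_{i−1}·Jᵢ` and `J_{i−1} + Jᵢ`; and `g₀` commutes with `J₀ + J₀⁻¹`. -/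
theorem murphy_elements_relations (n : ℕ) (hn : 2 ≤ n) (q Q1 Q2 : ℂ)
    (hq : q ≠ 0) (hQ1 : Q1 ≠ 0) (hQ2 : Q2 ≠ 0) :
    (∀ i j : ℕ, i ≤ n - 1 → j ≤ n - 1 →
      HJ n q Q1 Q2 i * HJ n q Q1 Q2 j = HJ n q Q1 Q2 j * HJ n q Q1 Q2 i) ∧
    (∀ j : ℕ, j ≤ n - 1 → j ≠ 0 →
      HG n q Q1 Q2 0 * HJ n q Q1 Q2 j = HJ n q Q1 Q2 j * HG n q Q1 Q2 0) ∧
    (∀ i j : ℕ, 1 ≤ i → i ≤ n - 1 → j ≤ n - 1 → j ≠ i - 1 → j ≠ i →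
      HG n q Q1 Q2 i * HJ n q Q1 Q2 j = HJ n q Q1 Q2 j * HG n q Q1 Q2 i) ∧
    (∀ i : ℕ, 1 ≤ i → i ≤ n - 1 →
      HG n q Q1 Q2 i * (HJ n q Q1 Q2 (i - 1) * HJ n q Q1 Q2 i)
        = (HJ n q Q1 Q2 (i - 1) * HJ n q Q1 Q2 i) * HG n q Q1 Q2 i) ∧
    (∀ i : ℕ, 1 ≤ i → i ≤ n - 1 →
      HG n q Q1 Q2 i * (HJ n q Q1 Q2 (i - 1) + HJ n q Q1 Q2 i)
        = (HJ n q Q1 Q2 (i - 1) + HJ n q Q1 Q2 i) * HG n q Q1 Q2 i) ∧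
    (HG n q Q1 Q2 0 * (HJ n q Q1 Q2 0 + Ring.inverse (HJ n q Q1 Q2 0))
        = (HJ n q Q1 Q2 0 + Ring.inverse (HJ n q Q1 Q2 0)) * HG n q Q1 Q2 0) := by
  have h := isBraidC_heckeGen hn hq hQ1 hQ2
  have hG : ∀ i, i ≤ n - 1 → (heckeGen n q Q1 Q2 i : HeckeC n q Q1 Q2) = HG n q Q1 Q2 i :=
    fun i hi => heckeGen_val hn hq hQ1 hQ2 (by omega)
  have hJ : ∀ k, k ≤ n - 1 →
      (IsBraidC.murphy n (heckeGen n q Q1 Q2) k).val = HJ n q Q1 Q2 k :=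
    fun k hk => murphy_heckeGen_val hn hq hQ1 hQ2 hk
  have hJJ : ∀ i j, i ≤ n - 1 → j ≤ n - 1 → Commute (HJ n q Q1 Q2 i) (HJ n q Q1 Q2 j) := by
    intro i j hi hj
    rw [← hJ i hi, ← hJ j hj]
    exact Commute.units_val (h.murphy_comm hi hj)
  have hGJ : ∀ i j, i ≤ n - 1 → j ≤ n - 1 → i ≠ j → i ≠ j + 1 →
      Commute (HG n q Q1 Q2 i) (HJ n q Q1 Q2 j) := by
    intro i j hi hj h1 h2
    rw [← hG i hi, ← hJ j hj]
    exact Commute.units_val (h.murphy_comm_gen hj hi h1 h2).symm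
  refine ⟨hJJ, fun j hj hj0 => hGJ 0 j (by omega) hj (by omega) (by omega),
    fun i j h1 hi hj hj1 hj2 => hGJ i j hi hj (by omega) (by omega), ?_, ?_,
    HG_comm_murphy_zero_add_inv hn hq hQ1 hQ2⟩
  · rintro (_ | k) h1 hk
    · omega
    have hc := (hJJ k (k + 1) (by omega) hk).eq
    simp only [Nat.add_sub_cancel]
    calc HG n q Q1 Q2 (k + 1) * (HJ n q Q1 Q2 k * HJ n q Q1 Q2 (k + 1))
        = HJ n q Q1 Q2 (k + 1) * HJ n q Q1 Q2 k * HG n q Q1 Q2 (k + 1) := by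
          simp only [HJ, mul_assoc]
      _ = HJ n q Q1 Q2 k * HJ n q Q1 Q2 (k + 1) * HG n q Q1 Q2 (k + 1) := by rw [hc]
  · rintro (_ | k) h1 hk
    · omega
    simp only [Nat.add_sub_cancel, HJ]
    refine commute_add_conj (a := algebraMap ℂ _
      (heckeParam n q Q1 Q2 (k + 1) - (heckeParam n q Q1 Q2 (k + 1))⁻¹)) ?_ (Algebra.commutes _)
    have hs := HG_quad hn hq hQ1 hQ2 (i := k + 1) (by omega)
    rw [mul_sub, sub_eq_iff_eq_add, ← Algebra.commutes] at hs
    exact hs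

end
end
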